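/- For every h̄ < 0, α ∈ (0,1), ε ∈ (0,1), and every h ≤ 0, the negative-side NLR test satisfies liminf_{n→∞} ∫ φ_n(y|h̄,ε) dP^n_{θ0+h/n}(y) ≥ min{e^{(h−h̄)/λ}, 1} − (1−α)·e^{h/λ}. -/

import Mathlib

open MeasureTheory Filter Real Topology

noncomputable section

attribute [local instance] Classical.propDecidable

/-- The benchmark nonregular model of Shimizu–Otsu, satisfying Assumption 1.
`f y θ` denotes the density kernel `f(y|θ)` and the data density is
`y ↦ f(y|θ) · 𝟙{y ≥ g θ}`. -/
structure BenchmarkModel where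
  θ0 : ℝ
  /-- density kernel, `f y θ = f(y|θ)` -/
  f : ℝ → ℝ → ℝ
  /-- boundary function -/
  g : ℝ → ℝ
  /-- open neighborhood of `θ0` -/
  N : Set ℝ
  /-- uniform bound on `f` over `N` -/
  C : ℝ
  N_open : IsOpen N
  θ0_mem : θ0 ∈ N
  /-- (a) `y ↦ f(y|θ)·𝟙{y ≥ g θ}` is a probability density for every `θ`. -/
  f_nonneg : ∀ θ y, g θ ≤ y → 0 ≤ f y θ
  f_integrable : ∀ θ, IntegrableOn (fun y => f y θ) (Set.Ici (g θ))
  f_density : ∀ θ, ∫ y in Set.Ici (g θ), f y θ = 1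
  /-- (b) `θ ↦ f(y|θ)` is twice continuously differentiable for every `y`. -/
  f_smooth : ∀ y, ContDiff ℝ 2 fun θ => f y θ
  /-- (c) continuity in `y` for `θ ∈ N`, and uniform positive bounds on `N` -/
  f_cont : ∀ θ ∈ N, Continuous fun y => f y θ
  fθ_cont : ∀ θ ∈ N, Continuous fun y => deriv (fun t => f y t) θ
  f_pos : ∀ θ ∈ N, ∀ y, 0 < f y θ
  f_lt : ∀ θ ∈ N, ∀ y, f y θ < C
  /-- (d) integrability of the suprema over `N` -/
  int1 : ∫⁻ y : ℝ, ⨆ θ ∈ N,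
      ENNReal.ofReal (|deriv (fun t => f y t) θ| * if g θ ≤ y then 1 else 0) < ⊤
  int2 : ∫⁻ y : ℝ, ⨆ θ ∈ N, ⨆ θ' ∈ N, ENNReal.ofReal
      ((deriv (fun t => f y t) θ') ^ 2 / (f y θ') ^ 2 *
        (if g θ ≤ y then 1 else 0) * f y θ) < ⊤
  int3 : ∫⁻ y : ℝ, ⨆ θ ∈ N, ⨆ θ' ∈ N, ENNReal.ofReal
      (|deriv (deriv fun t => f y t) θ'| / f y θ' *
        (if g θ ≤ y then 1 else 0) * f y θ) < ⊤
  /-- (e) conditions on `g` -/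
  g_smooth : ContDiff ℝ 1 g
  g_deriv_pos : 0 < deriv g θ0
  g_deriv_bdd : ∃ B, ∀ θ ∈ N, |deriv g θ| ≤ B

namespace BenchmarkModel

variable (M : BenchmarkModel)

/-- `λ = (f(g(θ0)|θ0)·g'(θ0))⁻¹`. -/
def lam : ℝ := (M.f (M.g M.θ0) M.θ0 * deriv M.g M.θ0)⁻¹

/-- The joint measure `P_θ^n` of an iid sample of size `n` on `ℝ^n`. -/
def P (n : ℕ) (θ : ℝ) : Measure (Fin n → ℝ) :=
  (volume : Measure (Fin n → ℝ)).withDensity fun y =>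
    ENNReal.ofReal (∏ i, M.f (y i) θ * if M.g θ ≤ y i then 1 else 0)

/-- The likelihood-ratio statistic `Z_n(h, h̄)`. -/
def Z (n : ℕ) (h hb : ℝ) : (Fin n → ℝ) → ℝ := fun y =>
  if ∀ i, M.g (M.θ0 + h / n) ≤ y i then
    (if ∀ i, M.g (M.θ0 + hb / n) ≤ y i then 1 else 0) *
      ∏ i, M.f (y i) (M.θ0 + hb / n) / M.f (y i) (M.θ0 + h / n)
  else 0

end BenchmarkModel

namespace BenchmarkModel

variable (M : BenchmarkModel)

/-- The negative-side NLR test `φ_n(·|h̄,ε)` at significance level `α`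
(rejection clause taking priority). -/
def phiMinus (n : ℕ) (hb ε α : ℝ) : (Fin n → ℝ) → ℝ := fun y =>
  if exp (hb / M.lam) * (1 + ε) < M.Z n 0 hb y ∨ ∃ i, y i < M.g M.θ0 then 1
  else if M.Z n 0 hb y ∈ Set.Icc (exp (hb / M.lam) * (1 - ε)) (exp (hb / M.lam) * (1 + ε)) then α
  else 0

end BenchmarkModel

namespace BenchmarkModel

section

variable (M : BenchmarkModel)

lemma continuous_g : Continuous M.g := M.g_smooth.continuous

lemma hasDerivAt_f (y θ : ℝ) :
    HasDerivAt (fun t => M.f y t) (deriv (fun t => M.f y t) θ) θ :=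
  ((M.f_smooth y).differentiable (by norm_num) θ).hasDerivAt

lemma hasDerivAt_g (θ : ℝ) : HasDerivAt M.g (deriv M.g θ) θ :=
  (M.g_smooth.differentiable (by norm_num) θ).hasDerivAt

lemma exists_left_window : ∃ δ > 0, Set.Icc (M.θ0 - δ) M.θ0 ⊆ M.N ∧
    StrictMonoOn M.g (Set.Icc (M.θ0 - δ) M.θ0) := by
  have hcont : Continuous (deriv M.g) := M.g_smooth.continuous_deriv (by norm_num)
  have h1 : ∀ᶠ θ in 𝓝 M.θ0, θ ∈ M.N ∧ 0 < deriv M.g θ :=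
    (M.N_open.eventually_mem M.θ0_mem).and
      (hcont.continuousAt.eventually (lt_mem_nhds M.g_deriv_pos))
  obtain ⟨r, hr, hball⟩ := Metric.eventually_nhds_iff.1 h1
  have hsub : ∀ θ ∈ Set.Icc (M.θ0 - r / 2) M.θ0, θ ∈ M.N ∧ 0 < deriv M.g θ := by
    intro θ hθ
    apply hball
    rw [Real.dist_eq, abs_lt]
    constructor <;> linarith [hθ.1, hθ.2]
  refine ⟨r / 2, by positivity, fun θ hθ => (hsub θ hθ).1, ?_⟩
  exact strictMonoOn_of_deriv_pos (convex_Icc _ _) M.continuous_g.continuousOn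
    fun x hx => (hsub x (interior_subset hx)).2

lemma ofReal_sq_sqrt_sub_sqrt_le {a b y : ℝ} (hab : a ≤ b) (hN : Set.Icc a b ⊆ M.N)
    {S : ENNReal} (hS : ∀ θ ∈ Set.Icc a b,
      ENNReal.ofReal ((deriv (fun t => M.f y t) θ) ^ 2 / M.f y θ) ≤ S) :
    ENNReal.ofReal ((√(M.f y a) - √(M.f y b)) ^ 2) ≤ ENNReal.ofReal ((b - a) ^ 2 / 4) * S := by
  rcases hab.eq_or_lt with rfl | hlt
  · simp
  have hd : ∀ θ ∈ Set.Icc a b, HasDerivAt (fun t => √(M.f y t))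
      (deriv (fun t => M.f y t) θ / (2 * √(M.f y θ))) θ := fun θ hθ =>
    (M.hasDerivAt_f y θ).sqrt (M.f_pos θ (hN hθ) y).ne'
  obtain ⟨c, hc, hcd⟩ := exists_hasDerivAt_eq_slope _ _ hlt
    (fun θ hθ => (hd θ hθ).continuousAt.continuousWithinAt)
    (fun θ hθ => hd θ (Set.Ioo_subset_Icc_self hθ))
  have hc' := Set.Ioo_subset_Icc_self hc
  have hpos := M.f_pos c (hN hc') y
  have hsq : (√(M.f y a) - √(M.f y b)) ^ 2 =
      (b - a) ^ 2 / 4 * ((deriv (fun t => M.f y t) c) ^ 2 / M.f y c) := by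
    rw [eq_div_iff (by linarith)] at hcd
    have : √(M.f y a) - √(M.f y b) =
        -(deriv (fun t => M.f y t) c / (2 * √(M.f y c)) * (b - a)) := by linarith
    rw [this, neg_sq, mul_pow, div_pow, mul_pow, Real.sq_sqrt hpos.le]
    field_simp
    norm_num
  rw [hsq, ENNReal.ofReal_mul (by positivity)]
  gcongr
  exact hS c hc'

/-- The integrand of the second envelope condition, as an extended nonnegative function. -/
def scoreEnvelope (y : ℝ) : ENNReal :=
  ⨆ θ ∈ M.N, ⨆ θ' ∈ M.N, ENNReal.ofReal
      ((deriv (fun t => M.f y t) θ') ^ 2 / (M.f y θ') ^ 2 *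
        (if M.g θ ≤ y then 1 else 0) * M.f y θ)

lemma le_scoreEnvelope {θ θ' y : ℝ} (hθ : θ ∈ M.N) (hθ' : θ' ∈ M.N) (hy : M.g θ ≤ y) :
    ENNReal.ofReal ((deriv (fun t => M.f y t) θ') ^ 2 / (M.f y θ') ^ 2 * M.f y θ) ≤
      M.scoreEnvelope y := by
  refine le_trans ?_ (le_iSup₂_of_le θ hθ (le_iSup₂_of_le θ' hθ' le_rfl))
  simp [hy]

lemma exists_information_le {δ : ℝ} (hδ : 0 < δ) (hN : Set.Icc (M.θ0 - δ) M.θ0 ⊆ M.N)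
    (hg : StrictMonoOn M.g (Set.Icc (M.θ0 - δ) M.θ0)) :
    ∃ R : ℝ, 0 ≤ R ∧ ∀ θ ∈ Set.Icc (M.θ0 - δ) M.θ0, ∀ y, M.g (M.θ0 - δ) ≤ y →
      ENNReal.ofReal ((deriv (fun t => M.f y t) θ) ^ 2 / M.f y θ) ≤
        ENNReal.ofReal R * M.scoreEnvelope y := by
  have hleft : M.θ0 - δ ∈ Set.Icc (M.θ0 - δ) M.θ0 := ⟨le_rfl, by linarith⟩
  have hright : M.θ0 ∈ Set.Icc (M.θ0 - δ) M.θ0 := ⟨by linarith, le_rfl⟩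
  have hgle : M.g (M.θ0 - δ) ≤ M.g M.θ0 := hg.monotoneOn hleft hright (by linarith)
  obtain ⟨y₀, -, hmin⟩ := (isCompact_Icc (a := M.g (M.θ0 - δ)) (b := M.g M.θ0)).exists_isMinOn
    ⟨_, le_rfl, hgle⟩ (M.f_cont _ (hN hleft)).continuousOn
  set m := M.f y₀ (M.θ0 - δ) with hm
  have hmpos : 0 < m := M.f_pos _ (hN hleft) _
  have hC : 0 < M.C := (M.f_pos _ M.θ0_mem 0).trans (M.f_lt _ M.θ0_mem 0)
  refine ⟨max 1 (M.C / m), by positivity, fun θ hθ y hy => ?_⟩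
  have hpos := M.f_pos θ (hN hθ) y
  set D := deriv (fun t => M.f y t) θ
  rcases le_total (M.g M.θ0) y with hy0 | hy0
  · have h1 := M.le_scoreEnvelope (hN hθ) (hN hθ)
      ((hg.monotoneOn hθ hright hθ.2).trans hy0)
    have h2 : D ^ 2 / M.f y θ ^ 2 * M.f y θ = D ^ 2 / M.f y θ := by
      field_simp
    rw [h2] at h1
    calc _ ≤ 1 * M.scoreEnvelope y := by simpa using h1
      _ ≤ _ := by
        gcongr
        simp
  · have h1 := M.le_scoreEnvelope (hN hleft) (hN hθ) hy
    have hmy : m ≤ M.f y (M.θ0 - δ) := hmin ⟨hy, hy0⟩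
    refine le_trans ?_ (mul_le_mul_right h1 _)
    rw [← ENNReal.ofReal_mul (by positivity)]
    apply ENNReal.ofReal_le_ofReal
    calc D ^ 2 / M.f y θ = D ^ 2 / M.f y θ ^ 2 * M.f y θ := by field_simp
      _ ≤ D ^ 2 / M.f y θ ^ 2 * M.C := by
        gcongr
        exact (M.f_lt θ (hN hθ) y).le
      _ = M.C / m * (D ^ 2 / M.f y θ ^ 2 * m) := by field_simp
      _ ≤ max 1 (M.C / m) * (D ^ 2 / M.f y θ ^ 2 * M.f y (M.θ0 - δ)) := by
        gcongr
        exact le_max_right _ _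

lemma exists_hellinger_le {δ : ℝ} (hδ : 0 < δ) (hN : Set.Icc (M.θ0 - δ) M.θ0 ⊆ M.N)
    (hg : StrictMonoOn M.g (Set.Icc (M.θ0 - δ) M.θ0)) :
    ∃ K : ℝ, ∀ θ ∈ Set.Icc (M.θ0 - δ) M.θ0,
      IntegrableOn (fun y => (√(M.f y θ) - √(M.f y M.θ0)) ^ 2) (Set.Ici (M.g (M.θ0 - δ))) ∧
      ∫ y in Set.Ici (M.g (M.θ0 - δ)), (√(M.f y θ) - √(M.f y M.θ0)) ^ 2 ≤
        K * (M.θ0 - θ) ^ 2 := by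
  obtain ⟨R, hR, hRS⟩ := M.exists_information_le hδ hN hg
  have hfin : ∫⁻ y, M.scoreEnvelope y < ⊤ := M.int2
  refine ⟨R / 4 * (∫⁻ y, M.scoreEnvelope y).toReal, fun θ hθ => ?_⟩
  have hmeas : AEStronglyMeasurable (fun y => (√(M.f y θ) - √(M.f y M.θ0)) ^ 2)
      (volume.restrict (Set.Ici (M.g (M.θ0 - δ)))) :=
    (((M.f_cont θ (hN hθ)).sqrt.sub (M.f_cont _ M.θ0_mem).sqrt).pow 2).aestronglyMeasurable
  have hnn : 0 ≤ᵐ[volume.restrict (Set.Ici (M.g (M.θ0 - δ)))]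
      fun y => (√(M.f y θ) - √(M.f y M.θ0)) ^ 2 := ae_of_all _ fun y => sq_nonneg _
  have hle : ∫⁻ y in Set.Ici (M.g (M.θ0 - δ)),
      ENNReal.ofReal ((√(M.f y θ) - √(M.f y M.θ0)) ^ 2) ≤
      ENNReal.ofReal ((M.θ0 - θ) ^ 2 / 4) * (ENNReal.ofReal R * ∫⁻ y, M.scoreEnvelope y) := by
    calc _ ≤ ∫⁻ y in Set.Ici (M.g (M.θ0 - δ)),
          ENNReal.ofReal ((M.θ0 - θ) ^ 2 / 4) * (ENNReal.ofReal R * M.scoreEnvelope y) := by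
          refine setLIntegral_mono' measurableSet_Ici fun y hy => ?_
          have hsub : Set.Icc θ M.θ0 ⊆ Set.Icc (M.θ0 - δ) M.θ0 := Set.Icc_subset_Icc_left hθ.1
          exact M.ofReal_sq_sqrt_sub_sqrt_le hθ.2 (hsub.trans hN)
            fun t ht => hRS t (hsub ht) y hy
      _ ≤ ∫⁻ y, ENNReal.ofReal ((M.θ0 - θ) ^ 2 / 4) *
          (ENNReal.ofReal R * M.scoreEnvelope y) := setLIntegral_le_lintegral _ _
      _ = _ := by
        rw [lintegral_const_mul' _ _ ENNReal.ofReal_ne_top,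
          lintegral_const_mul' _ _ ENNReal.ofReal_ne_top]
  have hlt : ENNReal.ofReal ((M.θ0 - θ) ^ 2 / 4) *
      (ENNReal.ofReal R * ∫⁻ y, M.scoreEnvelope y) < ⊤ :=
    ENNReal.mul_lt_top ENNReal.ofReal_lt_top (ENNReal.mul_lt_top ENNReal.ofReal_lt_top hfin)
  refine ⟨⟨hmeas, (hasFiniteIntegral_iff_ofReal hnn).2 (hle.trans_lt hlt)⟩, ?_⟩
  rw [integral_eq_lintegral_of_nonneg_ae hnn hmeas]
  refine (ENNReal.toReal_mono hlt.ne hle).trans (le_of_eq ?_)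
  rw [ENNReal.toReal_mul, ENNReal.toReal_mul, ENNReal.toReal_ofReal (by positivity),
    ENNReal.toReal_ofReal hR]
  ring

lemma lam_pos : 0 < M.lam :=
  inv_pos.2 (mul_pos (M.f_pos _ M.θ0_mem _) M.g_deriv_pos)

lemma tendsto_local (h : ℝ) : Tendsto (fun n : ℕ => M.θ0 + h / n) atTop (𝓝 M.θ0) := by
  simpa using (tendsto_const_div_atTop_nhds_zero_nat h).const_add M.θ0

lemma eventually_local_mem {δ h : ℝ} (hδ : 0 < δ) (hh : h ≤ 0) :
    ∀ᶠ n : ℕ in atTop, M.θ0 + h / n ∈ Set.Icc (M.θ0 - δ) M.θ0 := by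
  filter_upwards [(M.tendsto_local h).eventually (lt_mem_nhds (by linarith : M.θ0 - δ < M.θ0))]
    with n hn
  have : h / (n : ℝ) ≤ 0 := div_nonpos_of_nonpos_of_nonneg hh n.cast_nonneg
  exact ⟨hn.le, by linarith⟩

lemma tendsto_mul_integral_window (h : ℝ) :
    Tendsto (fun n : ℕ => n * ∫ y in M.g (M.θ0 + h / n)..M.g M.θ0, M.f y M.θ0) atTop
      (𝓝 (-(h / M.lam))) := by
  have h1 : HasDerivAt (fun u => ∫ y in M.g M.θ0..u, M.f y M.θ0) (M.f (M.g M.θ0) M.θ0)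
      (M.g M.θ0) := ((M.f_cont _ M.θ0_mem).integral_hasStrictDerivAt _ _).hasDerivAt
  have h2 : HasDerivAt (fun t : ℝ => M.θ0 + h * t) h 0 := by
    simpa using ((hasDerivAt_id (0 : ℝ)).const_mul h).const_add M.θ0
  have h3 : HasDerivAt (fun t : ℝ => M.g (M.θ0 + h * t)) (deriv M.g M.θ0 * h) 0 :=
    HasDerivAt.comp (0 : ℝ) (h₂ := M.g) (by simpa using M.hasDerivAt_g M.θ0) h2
  have h4 : HasDerivAt (fun t : ℝ => ∫ y in M.g M.θ0..M.g (M.θ0 + h * t), M.f y M.θ0)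
      (M.f (M.g M.θ0) M.θ0 * (deriv M.g M.θ0 * h)) 0 :=
    HasDerivAt.comp (0 : ℝ) (h₂ := fun u => ∫ y in M.g M.θ0..u, M.f y M.θ0)
      (by simpa using h1) h3
  have h5 : Tendsto (fun n : ℕ => ((n : ℝ))⁻¹) atTop (𝓝[≠] 0) := by
    refine tendsto_nhdsWithin_iff.2 ⟨tendsto_inv_atTop_nhds_zero_nat, ?_⟩
    filter_upwards [eventually_gt_atTop 0] with n hn
    simp [hn.ne']
  have h6 := (h4.tendsto_slope_zero.comp h5).neg
  have h7 : -(M.f (M.g M.θ0) M.θ0 * (deriv M.g M.θ0 * h)) = -(h / M.lam) := by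
    simp only [lam, div_inv_eq_mul]
    ring
  rw [h7] at h6
  refine h6.congr fun n => ?_
  simp only [Function.comp, zero_add, mul_zero, add_zero, intervalIntegral.integral_same, sub_zero,
    inv_inv, smul_eq_mul, div_eq_mul_inv]
  rw [intervalIntegral.integral_symm]
  ring

lemma f_integrableOn {θ : ℝ} (hθ : M.g θ ≤ M.g M.θ0) :
    IntegrableOn (fun y => M.f y θ) (Set.Ici (M.g M.θ0)) :=
  (M.f_integrable θ).mono_set (Set.Ici_subset_Ici.2 hθ)

lemma integral_window_add {θ : ℝ} (hθ : M.g θ ≤ M.g M.θ0) :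
    (∫ y in Set.Ico (M.g θ) (M.g M.θ0), M.f y θ) + ∫ y in Set.Ici (M.g M.θ0), M.f y θ = 1 := by
  rw [← M.f_density θ, ← Set.Ico_union_Ici_eq_Ici hθ, setIntegral_union _ measurableSet_Ici
    ((M.f_integrable θ).mono_set Set.Ico_subset_Ici_self) (M.f_integrableOn hθ)]
  exact Set.disjoint_left.2 fun x hx hx' => hx.2.not_ge hx'

lemma abs_sub_le_of_sqrt {x y κ : ℝ} (hx : 0 ≤ x) (hy : 0 ≤ y) (hκ : 0 < κ) :
    |x - y| ≤ κ⁻¹ * y + (κ + 1) * (√x - √y) ^ 2 := by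
  obtain ⟨a, ha, rfl⟩ : ∃ a, 0 ≤ a ∧ a ^ 2 = x := ⟨√x, Real.sqrt_nonneg x, Real.sq_sqrt hx⟩
  obtain ⟨b, hb, rfl⟩ : ∃ b, 0 ≤ b ∧ b ^ 2 = y := ⟨√y, Real.sqrt_nonneg y, Real.sq_sqrt hy⟩
  rw [Real.sqrt_sq ha, Real.sqrt_sq hb]
  have h1 : ∀ s : ℝ, 0 ≤ κ⁻¹ * b ^ 2 + κ * s ^ 2 - 2 * b * s := fun s => by
    have : κ⁻¹ * b ^ 2 + κ * s ^ 2 - 2 * b * s = κ⁻¹ * (b - κ * s) ^ 2 := by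
      field_simp
      ring
    rw [this]
    positivity
  rw [abs_le]
  constructor
  · nlinarith [h1 (-(a - b)), sq_nonneg (a - b)]
  · nlinarith [h1 (a - b), sq_nonneg (a - b)]

lemma tendsto_mul_mass_sub_one {h : ℝ} (hh : h ≤ 0) :
    Tendsto (fun n : ℕ => n * ((∫ y in Set.Ici (M.g M.θ0), M.f y (M.θ0 + h / n)) - 1)) atTop
      (𝓝 (h / M.lam)) := by
  obtain ⟨δ, hδ, hN, hg⟩ := M.exists_left_window
  obtain ⟨K, hK⟩ := M.exists_hellinger_le hδ hN hg
  have hleft : M.θ0 - δ ∈ Set.Icc (M.θ0 - δ) M.θ0 := ⟨le_rfl, by linarith⟩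
  have hright : M.θ0 ∈ Set.Icc (M.θ0 - δ) M.θ0 := ⟨by linarith, le_rfl⟩
  set w : ℕ → ℝ := fun n => n * ∫ y in M.g (M.θ0 + h / n)..M.g M.θ0, M.f y M.θ0 with hw
  have hwlim : Tendsto w atTop (𝓝 (-(h / M.lam))) := M.tendsto_mul_integral_window h
  have hκ : Tendsto (fun n : ℕ => (√(n : ℝ))⁻¹) atTop (𝓝 0) :=
    (Real.tendsto_sqrt_atTop.comp tendsto_natCast_atTop_atTop).inv_tendsto_atTop
  have hbound : Tendsto (fun n : ℕ => (√(n : ℝ))⁻¹ * w n +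
      ((√(n : ℝ))⁻¹ + (√(n : ℝ))⁻¹ * (√(n : ℝ))⁻¹) * (K * h ^ 2)) atTop (𝓝 0) := by
    simpa using (hκ.mul hwlim).add ((hκ.add (hκ.mul hκ)).mul_const (K * h ^ 2))
  have hdiff : Tendsto (fun n : ℕ =>
      n * ((∫ y in Set.Ici (M.g M.θ0), M.f y (M.θ0 + h / n)) - 1) + w n) atTop (𝓝 0) := by
    refine squeeze_zero_norm' ?_ hbound
    filter_upwards [M.eventually_local_mem hδ hh, eventually_gt_atTop 0] with n hn hn0
    set θ := M.θ0 + h / n with hθ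
    have hn0' : (0 : ℝ) < n := by exact_mod_cast hn0
    have hs : 0 < √(n : ℝ) := Real.sqrt_pos.2 hn0'
    have hgθ : M.g θ ≤ M.g M.θ0 := hg.monotoneOn hn hright hn.2
    have hgδ : M.g (M.θ0 - δ) ≤ M.g θ := hg.monotoneOn hleft hn hn.1
    obtain ⟨hint, hle⟩ := hK θ hn
    have hsub : Set.Ico (M.g θ) (M.g M.θ0) ⊆ Set.Ici (M.g (M.θ0 - δ)) :=
      fun x hx => hgδ.trans hx.1
    have hintJ := hint.mono_set hsub
    have hleJ : ∫ y in Set.Ico (M.g θ) (M.g M.θ0), (√(M.f y θ) - √(M.f y M.θ0)) ^ 2 ≤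
        K * (M.θ0 - θ) ^ 2 :=
      (setIntegral_mono_set hint (ae_of_all _ fun y => sq_nonneg _)
        (LE.le.eventuallyLE hsub)).trans hle
    have hfθ : IntegrableOn (fun y => M.f y θ) (Set.Ico (M.g θ) (M.g M.θ0)) :=
      (M.f_integrable θ).mono_set Set.Ico_subset_Ici_self
    have hf0 : IntegrableOn (fun y => M.f y M.θ0) (Set.Ico (M.g θ) (M.g M.θ0)) :=
      ((M.f_cont _ M.θ0_mem).integrableOn_Icc).mono_set Set.Ico_subset_Icc_self
    have hwn : w n = n * ∫ y in Set.Ico (M.g θ) (M.g M.θ0), M.f y M.θ0 := by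
      rw [hw]
      simp only
      rw [intervalIntegral.integral_of_le hgθ, integral_Ioc_eq_integral_Ioo,
        integral_Ico_eq_integral_Ioo]
    have hmass := M.integral_window_add hgθ
    have hrepr : n * ((∫ y in Set.Ici (M.g M.θ0), M.f y θ) - 1) + w n =
        -(n * ∫ y in Set.Ico (M.g θ) (M.g M.θ0), (M.f y θ - M.f y M.θ0)) := by
      rw [integral_sub hfθ hf0, hwn, ← hmass]
      ring
    rw [hrepr, norm_neg, norm_mul, Real.norm_natCast]
    calc n * ‖∫ y in Set.Ico (M.g θ) (M.g M.θ0), (M.f y θ - M.f y M.θ0)‖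
        ≤ n * ∫ y in Set.Ico (M.g θ) (M.g M.θ0), ((√(n : ℝ))⁻¹ * M.f y M.θ0 +
            (√(n : ℝ) + 1) * (√(M.f y θ) - √(M.f y M.θ0)) ^ 2) := by
          gcongr
          refine norm_integral_le_of_norm_le ((hf0.const_mul _).add (hintJ.const_mul _))
            (ae_of_all _ fun y => ?_)
          exact abs_sub_le_of_sqrt (M.f_pos θ (hN hn) y).le (M.f_pos _ M.θ0_mem y).le hs
      _ = (√(n : ℝ))⁻¹ * w n + n * (√(n : ℝ) + 1) *
            ∫ y in Set.Ico (M.g θ) (M.g M.θ0), (√(M.f y θ) - √(M.f y M.θ0)) ^ 2 := by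
          rw [integral_add (hf0.const_mul _) (hintJ.const_mul _), integral_const_mul,
            integral_const_mul, hwn]
          ring
      _ ≤ (√(n : ℝ))⁻¹ * w n + n * (√(n : ℝ) + 1) * (K * (M.θ0 - θ) ^ 2) := by
          gcongr
      _ = _ := by
          have hsq : (n : ℝ) = √(n : ℝ) ^ 2 := (Real.sq_sqrt hn0'.le).symm
          have : M.θ0 - θ = -(h / n) := by rw [hθ]; ring
          rw [this]
          generalize √(n : ℝ) = s at hs hsq
          rw [hsq]
          field_simp
  have := hdiff.sub hwlim
  simpa using this

lemma sqrt_mul_eq {x y : ℝ} (hx : 0 ≤ x) (hy : 0 ≤ y) :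
    √x * √y = (x + y - (√x - √y) ^ 2) / 2 := by
  nlinarith [Real.sq_sqrt hx, Real.sq_sqrt hy]

lemma tendsto_mul_affinity_sub_one {h : ℝ} (hh : h ≤ 0) :
    Tendsto (fun n : ℕ => n * ((∫ y in Set.Ici (M.g M.θ0),
      √(M.f y (M.θ0 + h / n)) * √(M.f y M.θ0)) - 1)) atTop (𝓝 (h / (2 * M.lam))) := by
  obtain ⟨δ, hδ, hN, hg⟩ := M.exists_left_window
  obtain ⟨K, hK⟩ := M.exists_hellinger_le hδ hN hg
  have hleft : M.θ0 - δ ∈ Set.Icc (M.θ0 - δ) M.θ0 := ⟨le_rfl, by linarith⟩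
  have hright : M.θ0 ∈ Set.Icc (M.θ0 - δ) M.θ0 := ⟨by linarith, le_rfl⟩
  have hsub : Set.Ici (M.g M.θ0) ⊆ Set.Ici (M.g (M.θ0 - δ)) :=
    Set.Ici_subset_Ici.2 (hg.monotoneOn hleft hright hright.1)
  have hH : Tendsto (fun n : ℕ => n * ∫ y in Set.Ici (M.g M.θ0),
      (√(M.f y (M.θ0 + h / n)) - √(M.f y M.θ0)) ^ 2) atTop (𝓝 0) := by
    have hlim : Tendsto (fun n : ℕ => K * h ^ 2 / n) atTop (𝓝 0) :=
      tendsto_const_div_atTop_nhds_zero_nat _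
    refine squeeze_zero' (Eventually.of_forall fun n => ?_) ?_ hlim
    · exact mul_nonneg n.cast_nonneg (integral_nonneg fun y => sq_nonneg _)
    filter_upwards [M.eventually_local_mem hδ hh, eventually_gt_atTop 0] with n hn hn0
    have hn0' : (0 : ℝ) < n := by exact_mod_cast hn0
    obtain ⟨hint, hle⟩ := hK _ hn
    calc _ ≤ n * (K * (M.θ0 - (M.θ0 + h / n)) ^ 2) := by
          gcongr
          exact (setIntegral_mono_set hint (ae_of_all _ fun y => sq_nonneg _)
            (LE.le.eventuallyLE hsub)).trans hle
      _ = _ := by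
          field_simp
          ring
  have hlim := ((M.tendsto_mul_mass_sub_one hh).sub hH).div_const 2
  have : (h / M.lam - 0) / 2 = h / (2 * M.lam) := by
    rw [sub_zero, div_div, mul_comm]
  rw [this] at hlim
  refine hlim.congr' ?_
  filter_upwards [M.eventually_local_mem hδ hh] with n hn
  have hint := (hK _ hn).1.mono_set hsub
  have h0 := M.f_integrableOn le_rfl
  have h1 := M.f_integrableOn (hg.monotoneOn hn hright hn.2)
  have h01 : IntegrableOn (fun y => M.f y (M.θ0 + h / n) + M.f y M.θ0)
      (Set.Ici (M.g M.θ0)) := h1.add h0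
  simp_rw [fun y => sqrt_mul_eq (M.f_pos _ (hN hn) y).le (M.f_pos _ M.θ0_mem y).le]
  rw [integral_div, integral_sub h01 hint, integral_add h1 h0, M.f_density M.θ0]
  ring

/-- The square root of the one-observation density, restricted to the support under `θ0`. -/
def rootDensity (θ : ℝ) : ℝ → ℝ :=
  (Set.Ici (M.g M.θ0)).indicator fun x => √(M.f x θ)

/-- The square root of the sample likelihood, restricted to the support under `θ0`. -/
def rootLik (n : ℕ) (θ : ℝ) (y : Fin n → ℝ) : ℝ := ∏ i, M.rootDensity θ (y i)

lemma rootDensity_mul (θ θ' x : ℝ) : M.rootDensity θ x * M.rootDensity θ' x =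
    (Set.Ici (M.g M.θ0)).indicator (fun x => √(M.f x θ) * √(M.f x θ')) x := by
  by_cases hx : x ∈ Set.Ici (M.g M.θ0) <;> simp [rootDensity, hx]

lemma integral_rootDensity_mul (θ θ' : ℝ) : ∫ x, M.rootDensity θ x * M.rootDensity θ' x =
    ∫ x in Set.Ici (M.g M.θ0), √(M.f x θ) * √(M.f x θ') := by
  simp_rw [rootDensity_mul]
  exact integral_indicator measurableSet_Ici

lemma integrable_rootDensity_mul {θ θ' : ℝ} (hN : θ ∈ M.N) (hN' : θ' ∈ M.N)
    (hg : M.g θ ≤ M.g M.θ0) (hg' : M.g θ' ≤ M.g M.θ0) :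
    Integrable fun x => M.rootDensity θ x * M.rootDensity θ' x := by
  simp_rw [rootDensity_mul]
  rw [integrable_indicator_iff measurableSet_Ici]
  refine Integrable.mono' ((M.f_integrableOn hg).add (M.f_integrableOn hg'))
    ((M.f_cont θ hN).sqrt.mul (M.f_cont θ' hN').sqrt).aestronglyMeasurable
    (ae_of_all _ fun x => ?_)
  have h1 := (M.f_pos θ hN x).le
  have h2 := (M.f_pos θ' hN' x).le
  rw [Real.norm_of_nonneg (by positivity)]
  simp only [Pi.add_apply]
  nlinarith [sqrt_mul_eq h1 h2, sq_nonneg (√(M.f x θ) - √(M.f x θ'))]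

lemma integrable_rootLik_mul {θ θ' : ℝ} (hN : θ ∈ M.N) (hN' : θ' ∈ M.N)
    (hg : M.g θ ≤ M.g M.θ0) (hg' : M.g θ' ≤ M.g M.θ0) (n : ℕ) :
    Integrable fun y => M.rootLik n θ y * M.rootLik n θ' y := by
  simp_rw [rootLik, ← Finset.prod_mul_distrib]
  exact Integrable.fintype_prod (f := fun _ x => M.rootDensity θ x * M.rootDensity θ' x)
    fun _ => M.integrable_rootDensity_mul hN hN' hg hg'

lemma integral_rootLik_mul (n : ℕ) (θ θ' : ℝ) :
    ∫ y, M.rootLik n θ y * M.rootLik n θ' y =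
      (∫ x in Set.Ici (M.g M.θ0), √(M.f x θ) * √(M.f x θ')) ^ n := by
  simp_rw [rootLik, ← Finset.prod_mul_distrib]
  rw [volume_pi, integral_fintype_prod_eq_pow (fun x => M.rootDensity θ x * M.rootDensity θ' x),
    integral_rootDensity_mul, Fintype.card_fin]

lemma tendsto_integral_rootLik_mul_self {h : ℝ} (hh : h ≤ 0) :
    Tendsto (fun n : ℕ => ∫ y, M.rootLik n (M.θ0 + h / n) y * M.rootLik n (M.θ0 + h / n) y)
      atTop (𝓝 (exp (h / M.lam))) := by
  obtain ⟨δ, hδ, hN, -⟩ := M.exists_left_window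
  refine (Real.tendsto_one_add_pow_exp_of_tendsto (M.tendsto_mul_mass_sub_one hh)).congr' ?_
  filter_upwards [M.eventually_local_mem hδ hh] with n hn
  rw [integral_rootLik_mul, add_sub_cancel]
  congr 1
  exact integral_congr_ae (ae_of_all _ fun y =>
    (Real.mul_self_sqrt (M.f_pos _ (hN hn) y).le).symm)

lemma tendsto_integral_rootLik_mul {h : ℝ} (hh : h ≤ 0) :
    Tendsto (fun n : ℕ => ∫ y, M.rootLik n (M.θ0 + h / n) y * M.rootLik n M.θ0 y)
      atTop (𝓝 (exp (h / (2 * M.lam)))) := by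
  refine (Real.tendsto_one_add_pow_exp_of_tendsto (M.tendsto_mul_affinity_sub_one hh)).congr
    fun n => ?_
  rw [integral_rootLik_mul, add_sub_cancel]

/-- The points `θ0 + h / n`, `h ≤ 0`, eventually lie in `N` with support containing that of `θ0`. -/
lemma eventually_local {h : ℝ} (hh : h ≤ 0) :
    ∀ᶠ n : ℕ in atTop, M.θ0 + h / n ∈ M.N ∧ M.g (M.θ0 + h / n) ≤ M.g M.θ0 := by
  obtain ⟨δ, hδ, hN, hg⟩ := M.exists_left_window
  filter_upwards [M.eventually_local_mem hδ hh] with n hn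
  exact ⟨hN hn, hg.monotoneOn hn ⟨by linarith, le_rfl⟩ hn.2⟩

lemma integrable_sq_rootLik_sub {θ : ℝ} (hN : θ ∈ M.N) (hg : M.g θ ≤ M.g M.θ0) (n : ℕ) (a : ℝ) :
    Integrable fun y => (M.rootLik n θ y - a * M.rootLik n M.θ0 y) ^ 2 := by
  have := ((M.integrable_rootLik_mul hN hN hg hg n).sub
    ((M.integrable_rootLik_mul hN M.θ0_mem hg le_rfl n).const_mul (2 * a))).add
    ((M.integrable_rootLik_mul M.θ0_mem M.θ0_mem le_rfl le_rfl n).const_mul (a ^ 2))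
  refine this.congr (ae_of_all _ fun y => ?_)
  simp only [Pi.add_apply, Pi.sub_apply]
  ring

/-- Asymptotic constancy, in mean square, of the square root of the likelihood ratio. -/
lemma tendsto_integral_sq_rootLik_sub {h : ℝ} (hh : h ≤ 0) :
    Tendsto (fun n : ℕ => ∫ y, (M.rootLik n (M.θ0 + h / n) y -
      exp (h / (2 * M.lam)) * M.rootLik n M.θ0 y) ^ 2) atTop (𝓝 0) := by
  have h0 := M.tendsto_integral_rootLik_mul_self le_rfl
  simp only [zero_div, add_zero, Real.exp_zero] at h0
  set a := exp (h / (2 * M.lam)) with ha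
  have ha2 : exp (h / M.lam) = a ^ 2 := by
    rw [ha, ← Real.exp_nat_mul]
    congr 1
    have := M.lam_pos
    field_simp
    norm_num
  have hlim := ((M.tendsto_integral_rootLik_mul_self hh).sub
    ((M.tendsto_integral_rootLik_mul hh).const_mul (2 * a))).add (h0.const_mul (a ^ 2))
  rw [← ha, ha2] at hlim
  have hz : a ^ 2 - 2 * a * a + a ^ 2 * 1 = 0 := by ring
  rw [hz] at hlim
  refine hlim.congr' ?_
  filter_upwards [M.eventually_local hh] with n ⟨hN, hg⟩
  have i1 := M.integrable_rootLik_mul hN hN hg hg n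
  have i2 := (M.integrable_rootLik_mul hN M.θ0_mem hg le_rfl n).const_mul (2 * a)
  have i3 := (M.integrable_rootLik_mul M.θ0_mem M.θ0_mem le_rfl le_rfl n).const_mul (a ^ 2)
  have i12 : Integrable fun y =>
      M.rootLik n (M.θ0 + h / n) y * M.rootLik n (M.θ0 + h / n) y -
        2 * a * (M.rootLik n (M.θ0 + h / n) y * M.rootLik n M.θ0 y) := i1.sub i2
  rw [← integral_const_mul, ← integral_const_mul, ← integral_sub i1 i2, ← integral_add i12 i3]
  refine integral_congr_ae (ae_of_all _ fun y => ?_)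
  ring

lemma rootLik_nonneg (n : ℕ) (θ : ℝ) (y : Fin n → ℝ) : 0 ≤ M.rootLik n θ y :=
  Finset.prod_nonneg fun _ _ => Set.indicator_nonneg (fun _ _ => Real.sqrt_nonneg _) _

lemma sq_rootLik {n : ℕ} {θ : ℝ} (hN : θ ∈ M.N) {y : Fin n → ℝ}
    (hy : ∀ i, M.g M.θ0 ≤ y i) : M.rootLik n θ y ^ 2 = ∏ i, M.f (y i) θ := by
  rw [rootLik, ← Finset.prod_pow]
  refine Finset.prod_congr rfl fun i _ => ?_
  rw [rootDensity, Set.indicator_of_mem (Set.mem_Ici.2 (hy i)), Real.sq_sqrt (M.f_pos θ hN _).le]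

/-- The joint density of a sample of size `n`. -/
def lik (n : ℕ) (θ : ℝ) (y : Fin n → ℝ) : ℝ :=
  ∏ i, M.f (y i) θ * if M.g θ ≤ y i then 1 else 0

lemma density_eq_indicator (θ x : ℝ) : (M.f x θ * if M.g θ ≤ x then 1 else 0) =
    (Set.Ici (M.g θ)).indicator (fun x => M.f x θ) x := by
  by_cases hx : M.g θ ≤ x <;> simp [Set.indicator, hx]

lemma lik_nonneg (n : ℕ) (θ : ℝ) (y : Fin n → ℝ) : 0 ≤ M.lik n θ y := by
  refine Finset.prod_nonneg fun i _ => ?_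
  rw [density_eq_indicator]
  exact Set.indicator_nonneg (fun x hx => M.f_nonneg θ x hx) _

lemma integrable_lik (n : ℕ) (θ : ℝ) : Integrable (M.lik n θ) := by
  refine Integrable.fintype_prod (f := fun _ x => M.f x θ * if M.g θ ≤ x then 1 else 0)
    fun _ => ?_
  simp_rw [density_eq_indicator]
  exact (integrable_indicator_iff measurableSet_Ici).2 (M.f_integrable θ)

lemma integral_lik (n : ℕ) (θ : ℝ) : ∫ y, M.lik n θ y = 1 := by
  simp_rw [lik]
  rw [volume_pi, integral_fintype_prod_eq_pow (fun x => M.f x θ * if M.g θ ≤ x then 1 else 0)]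
  simp_rw [density_eq_indicator]
  rw [integral_indicator measurableSet_Ici, M.f_density, one_pow]

lemma measurable_lik (n : ℕ) {θ : ℝ} (hN : θ ∈ M.N) : Measurable (M.lik n θ) := by
  refine Finset.measurable_prod _ fun i _ => ?_
  refine ((M.f_cont θ hN).measurable.comp (measurable_pi_apply i)).mul ?_
  exact Measurable.ite (measurableSet_le measurable_const (measurable_pi_apply i))
    measurable_const measurable_const

lemma measurableSet_forall_le (n : ℕ) (c : ℝ) : MeasurableSet {y : Fin n → ℝ | ∀ i, c ≤ y i} := by
  rw [Set.ofPred_forall]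
  exact MeasurableSet.iInter fun i => measurableSet_le measurable_const (measurable_pi_apply i)

lemma measurable_Z (n : ℕ) {h hb : ℝ} (hN : M.θ0 + h / n ∈ M.N) (hN' : M.θ0 + hb / n ∈ M.N) :
    Measurable (M.Z n h hb) := by
  refine Measurable.ite (measurableSet_forall_le n _) ?_ measurable_const
  refine (Measurable.ite (measurableSet_forall_le n _) measurable_const measurable_const).mul ?_
  exact Finset.measurable_prod _ fun i _ =>
    ((M.f_cont _ hN').measurable.comp (measurable_pi_apply i)).div
      ((M.f_cont _ hN).measurable.comp (measurable_pi_apply i))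

lemma measurable_phiMinus (n : ℕ) {hb : ℝ} (ε α : ℝ) (hN : M.θ0 + hb / n ∈ M.N) :
    Measurable (M.phiMinus n hb ε α) := by
  have hZ : Measurable (M.Z n 0 hb) := M.measurable_Z n (by simpa using M.θ0_mem) hN
  refine Measurable.ite ?_ measurable_const
    (Measurable.ite (hZ measurableSet_Icc) measurable_const measurable_const)
  refine (measurableSet_lt measurable_const hZ).union ?_
  change MeasurableSet {y : Fin n → ℝ | ∃ i, y i < M.g M.θ0}
  rw [Set.ofPred_exists]
  exact MeasurableSet.iUnion fun i => measurableSet_lt (measurable_pi_apply i) measurable_const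

lemma phiMinus_mem_Icc (n : ℕ) (hb ε : ℝ) {α : ℝ} (hα : α ∈ Set.Icc (0 : ℝ) 1)
    (y : Fin n → ℝ) : M.phiMinus n hb ε α y ∈ Set.Icc (0 : ℝ) 1 := by
  unfold phiMinus
  split_ifs
  · simp
  · exact hα
  · simp

lemma le_phiMinus {n : ℕ} {hb ε α : ℝ} (hα : α ≤ 1) {y : Fin n → ℝ}
    (hZ : exp (hb / M.lam) * (1 - ε) ≤ M.Z n 0 hb y) : α ≤ M.phiMinus n hb ε α y := by
  unfold phiMinus
  split_ifs with h1 h2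
  · exact hα
  · exact le_rfl
  · exact absurd ⟨hZ, not_lt.1 fun h => h1 (Or.inl h)⟩ h2

lemma Z_zero_mul_sq_rootLik {n : ℕ} {hb : ℝ} (hN : M.θ0 + hb / n ∈ M.N)
    (hg : M.g (M.θ0 + hb / n) ≤ M.g M.θ0) {y : Fin n → ℝ} (hy : ∀ i, M.g M.θ0 ≤ y i) :
    M.Z n 0 hb y * M.rootLik n M.θ0 y ^ 2 = M.rootLik n (M.θ0 + hb / n) y ^ 2 := by
  rw [M.sq_rootLik M.θ0_mem hy, M.sq_rootLik hN hy]
  have h1 : ∀ i, M.g (M.θ0 + hb / n) ≤ y i := fun i => hg.trans (hy i)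
  simp only [Z, zero_div, add_zero, hy, h1, implies_true, if_true, one_mul]
  rw [← Finset.prod_mul_distrib]
  exact Finset.prod_congr rfl fun i _ => div_mul_cancel₀ _ (M.f_pos _ M.θ0_mem _).ne'

lemma lik_eq_sq_rootLik {n : ℕ} {θ : ℝ} (hN : θ ∈ M.N) (hg : M.g θ ≤ M.g M.θ0)
    {y : Fin n → ℝ} (hy : ∀ i, M.g M.θ0 ≤ y i) : M.lik n θ y = M.rootLik n θ y ^ 2 := by
  rw [M.sq_rootLik hN hy, lik]
  exact Finset.prod_congr rfl fun i _ => by simp [hg.trans (hy i)]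

lemma integral_P {n : ℕ} {θ : ℝ} (hN : θ ∈ M.N) (u : (Fin n → ℝ) → ℝ) :
    ∫ y, u y ∂ M.P n θ = ∫ y, M.lik n θ y * u y := by
  change ∫ y, u y ∂ volume.withDensity (fun y => ENNReal.ofReal (M.lik n θ y)) = _
  rw [integral_withDensity_eq_integral_toReal_smul (M.measurable_lik n hN).ennreal_ofReal
    (ae_of_all _ fun y => ENNReal.ofReal_lt_top)]
  simp only [ENNReal.toReal_ofReal (M.lik_nonneg n θ _), smul_eq_mul]

lemma exists_le_lik_mul_phiMinus {hb α ε : ℝ} (hα : α ∈ Set.Ioo (0 : ℝ) 1)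
    (hε : ε ∈ Set.Ioo (0 : ℝ) 1) (a : ℝ) :
    ∃ κ : ℝ, ∀ (n : ℕ) (θ : ℝ), θ ∈ M.N → M.g θ ≤ M.g M.θ0 →
      M.θ0 + hb / n ∈ M.N → M.g (M.θ0 + hb / n) ≤ M.g M.θ0 → ∀ y : Fin n → ℝ,
      M.lik n θ y - (1 - α) * (M.rootLik n θ y * M.rootLik n θ y) -
        2 * (M.rootLik n θ y - a * M.rootLik n M.θ0 y) ^ 2 -
        κ * (M.rootLik n (M.θ0 + hb / n) y -
          exp (hb / (2 * M.lam)) * M.rootLik n M.θ0 y) ^ 2 ≤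
      M.lik n θ y * M.phiMinus n hb ε α y := by
  set b := exp (hb / (2 * M.lam)) with hb_def
  have hb2 : exp (hb / M.lam) = b ^ 2 := by
    rw [hb_def, ← Real.exp_nat_mul]
    congr 1
    have := M.lam_pos
    field_simp
    norm_num
  have hbpos : 0 < b := Real.exp_pos _
  set s := √(1 - ε) with hs
  have hs2 : s ^ 2 = 1 - ε := Real.sq_sqrt (by linarith [hε.2])
  have hs0 : 0 ≤ s := Real.sqrt_nonneg _
  have hs1 : s < 1 := by nlinarith [hε.1]
  set d := b * (1 - s) with hd
  have hdpos : 0 < d := mul_pos hbpos (by linarith)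
  refine ⟨2 * a ^ 2 / d ^ 2, fun n θ hN hg hN' hg' y => ?_⟩
  set A := M.rootLik n M.θ0 y
  set B := M.rootLik n θ y
  set D := M.rootLik n (M.θ0 + hb / n) y with hD
  have hA : 0 ≤ A := M.rootLik_nonneg n _ y
  have hDnn : 0 ≤ D := M.rootLik_nonneg n _ y
  have hκ : 0 ≤ 2 * a ^ 2 / d ^ 2 * (D - b * A) ^ 2 := by positivity
  have hB : 0 ≤ (1 - α) * (B * B) := mul_nonneg (by linarith [hα.2]) (mul_self_nonneg B)
  have hBA := sq_nonneg (B - a * A)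
  by_cases hy : ∀ i, M.g M.θ0 ≤ y i
  · rw [M.lik_eq_sq_rootLik hN hg hy]
    by_cases hZ : exp (hb / M.lam) * (1 - ε) ≤ M.Z n 0 hb y
    · have := mul_le_mul_of_nonneg_left (M.le_phiMinus hα.2.le hZ) (sq_nonneg B)
      nlinarith
    · have hφ := (M.phiMinus_mem_Icc n hb ε (Set.Ioo_subset_Icc_self hα) y).1
      have hDA : D ^ 2 ≤ (s * b * A) ^ 2 := by
        rw [hD, ← M.Z_zero_mul_sq_rootLik hN' hg' hy, mul_pow, mul_pow, hs2, mul_comm (1 - ε),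
          ← hb2]
        exact mul_le_mul_of_nonneg_right (not_le.1 hZ).le (sq_nonneg _)
      have hDA' : D ≤ s * b * A :=
        (abs_le.1 (abs_le_of_sq_le_sq hDA (by positivity))).2
      have hdA : d * A ≤ b * A - D := by rw [hd]; linarith
      have hdA2 : d ^ 2 * A ^ 2 ≤ (D - b * A) ^ 2 := by
        nlinarith [mul_nonneg hdpos.le hA]
      have hfinal : 2 * a ^ 2 * A ^ 2 ≤ 2 * a ^ 2 / d ^ 2 * (D - b * A) ^ 2 := by
        calc 2 * a ^ 2 * A ^ 2 = 2 * a ^ 2 / d ^ 2 * (d ^ 2 * A ^ 2) := by field_simp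
          _ ≤ _ := by gcongr
      have hsplit : B ^ 2 ≤ 2 * (B - a * A) ^ 2 + 2 * a ^ 2 * A ^ 2 := by
        nlinarith [sq_nonneg (B - 2 * (a * A))]
      have hnn : 0 ≤ B ^ 2 * M.phiMinus n hb ε α y := by positivity
      linarith
  · push Not at hy
    have hφ : M.phiMinus n hb ε α y = 1 := if_pos (Or.inr hy)
    rw [hφ, mul_one]
    linarith

end

/-- Lemma 2(ii): lower bound on the asymptotic local power of the negative-side NLR test. -/
theorem nlr_minus_power (M : BenchmarkModel) (hb α ε h : ℝ) (hhb : hb < 0)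
    (hα : α ∈ Set.Ioo (0 : ℝ) 1) (hε : ε ∈ Set.Ioo (0 : ℝ) 1) (hh : h ≤ 0) :
    min (exp ((h - hb) / M.lam)) 1 - (1 - α) * exp (h / M.lam) ≤
      Filter.liminf (fun n : ℕ => ∫ y, M.phiMinus n hb ε α y ∂ M.P n (M.θ0 + h / n)) atTop := by
  set a := exp (h / (2 * M.lam)) with ha
  obtain ⟨κ, hκ⟩ := M.exists_le_lik_mul_phiMinus (hb := hb) hα hε a
  have hlim := (((M.tendsto_integral_rootLik_mul_self hh).const_mul (1 - α)).const_sub 1 |>.sub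
    ((M.tendsto_integral_sq_rootLik_sub hh).const_mul 2)).sub
    ((M.tendsto_integral_sq_rootLik_sub hhb.le).const_mul κ)
  simp only [mul_zero, sub_zero] at hlim
  rw [← ha] at hlim
  have hφint : ∀ᶠ n : ℕ in atTop, Integrable fun y =>
      M.lik n (M.θ0 + h / n) y * M.phiMinus n hb ε α y := by
    filter_upwards [M.eventually_local hh, M.eventually_local hhb.le] with n ⟨hN, _⟩ ⟨hN', _⟩
    refine (M.integrable_lik n _).mul_bdd (c := 1)
      (M.measurable_phiMinus n ε α hN').aestronglyMeasurable (ae_of_all _ fun y => ?_)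
    have := M.phiMinus_mem_Icc n hb ε (Set.Ioo_subset_Icc_self hα) y
    rw [Real.norm_of_nonneg this.1]
    exact this.2
  have hupper : ∀ᶠ n : ℕ in atTop,
      ∫ y, M.phiMinus n hb ε α y ∂ M.P n (M.θ0 + h / n) ≤ 1 := by
    filter_upwards [M.eventually_local hh, hφint] with n ⟨hN, _⟩ hint
    rw [M.integral_P hN, ← M.integral_lik n (M.θ0 + h / n)]
    refine integral_mono hint (M.integrable_lik n _) fun y => ?_
    exact mul_le_of_le_one_right (M.lik_nonneg n _ y)
      (M.phiMinus_mem_Icc n hb ε (Set.Ioo_subset_Icc_self hα) y).2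
  have hlower : ∀ᶠ n : ℕ in atTop,
      1 - (1 - α) * (∫ y, M.rootLik n (M.θ0 + h / n) y * M.rootLik n (M.θ0 + h / n) y) -
        2 * (∫ y, (M.rootLik n (M.θ0 + h / n) y - a * M.rootLik n M.θ0 y) ^ 2) -
        κ * (∫ y, (M.rootLik n (M.θ0 + hb / n) y -
          exp (hb / (2 * M.lam)) * M.rootLik n M.θ0 y) ^ 2) ≤
      ∫ y, M.phiMinus n hb ε α y ∂ M.P n (M.θ0 + h / n) := by
    filter_upwards [M.eventually_local hh, M.eventually_local hhb.le, hφint]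
      with n ⟨hN, hg⟩ ⟨hN', hg'⟩ hint
    have i0 := M.integrable_lik n (M.θ0 + h / n)
    have i1 := (M.integrable_rootLik_mul hN hN hg hg n).const_mul (1 - α)
    have i2 := (M.integrable_sq_rootLik_sub hN hg n a).const_mul 2
    have i3 := (M.integrable_sq_rootLik_sub hN' hg' n (exp (hb / (2 * M.lam)))).const_mul κ
    rw [M.integral_P hN]
    refine le_trans (le_of_eq ?_)
      (integral_mono (((i0.sub i1).sub i2).sub i3) hint fun y => hκ n _ hN hg hN' hg' y)
    rw [integral_sub' ((i0.sub i1).sub i2) i3, integral_sub' (i0.sub i1) i2, integral_sub' i0 i1,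
      integral_lik, integral_const_mul, integral_const_mul, integral_const_mul]
  calc min (exp ((h - hb) / M.lam)) 1 - (1 - α) * exp (h / M.lam)
      ≤ 1 - (1 - α) * exp (h / M.lam) := by linarith [min_le_right (exp ((h - hb) / M.lam)) 1]
    _ = _ := hlim.liminf_eq.symm
    _ ≤ _ := liminf_le_liminf hlower hlim.isBoundedUnder_ge
        (isBoundedUnder_of_eventually_le hupper).isCoboundedUnder_ge

end BenchmarkModel
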